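/- A leakage-free deterministic selector under a non-product feature distribution: let d = 3, let x be uniform on the three one-hot vectors e_1, e_2, e_3 ∈ {0,1}^3, let y = 2 when x = e_1, y = 1 when x = e_2, and y = 0 when x = e_3, and let ζ be the deterministic selector with ζ(e_i | e_i) = 1 for i = 1,2,3 (select exactly the feature whose value is 1). Then ζ has no label leakage and no feature leakage. -/

import Mathlib

open Finset

noncomputable section

/-- A feature mask over `d` features: `true` means the feature is selected. -/
abbrev Mask (d : ℕ) := Fin d → Bool

variable {d : ℕ} {V : Fin d → Type*} {Y : Type*}

/-- The masked feature vector `x ⊙ h`: selected features keep their value,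
non-selected features are replaced by the masking symbol `none` (∅). -/
def applyMask (x : ∀ i, V i) (h : Mask d) : ∀ i, Option (V i) :=
  fun i => if h i then some (x i) else none

/-- The number of selected features `‖h‖₀`, as a real number. -/
def maskSize {d : ℕ} (h : Mask d) : ℝ :=
  ((Finset.univ.filter fun i => h i = true).card : ℝ)

section Leakage

variable [∀ i, Fintype (V i)] [∀ i, DecidableEq (V i)] [∀ i, Nonempty (V i)]
  [Fintype Y] [DecidableEq Y]

variable (p : (∀ i, V i) → Y → ℝ) (ζ : (∀ i, V i) → Mask d → ℝ)

/-- Marginal probability `p(x)`. -/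
def pX (x : ∀ i, V i) : ℝ := ∑ y, p x y

/-- `p` is a probability distribution on `X × Y`. -/
def IsDist : Prop := (∀ x y, 0 ≤ p x y) ∧ (∑ x, ∑ y, p x y) = 1

/-- `ζ` is a feature selector: for every `x` with `p(x) > 0`, `ζ(·|x)` is a
probability distribution over masks. -/
def IsSelector : Prop :=
  (∀ x h, 0 ≤ ζ x h) ∧ ∀ x, 0 < pX p x → (∑ h : Mask d, ζ x h) = 1

/-- `p(x[s^in])`: probability that the features selected by `h` take the values `x[s^in]`. -/
def pIn (h : Mask d) (x : ∀ i, V i) : ℝ :=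
  ∑ x' ∈ univ.filter (fun x' => applyMask x' h = applyMask x h), pX p x'

/-- `p(x[s^in], y)`. -/
def pInY (h : Mask d) (x : ∀ i, V i) (y : Y) : ℝ :=
  ∑ x' ∈ univ.filter (fun x' => applyMask x' h = applyMask x h), p x' y

/-- `p(x[s^in], h[s^in]=1, h[s^ex]=0)` under the joint distribution `p(x,y)·ζ(h|x)`. -/
def pInSel (h : Mask d) (x : ∀ i, V i) : ℝ :=
  ∑ x' ∈ univ.filter (fun x' => applyMask x' h = applyMask x h), pX p x' * ζ x' h

/-- `p(x[s^in], y, h[s^in]=1, h[s^ex]=0)`. -/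
def pInYSel (h : Mask d) (x : ∀ i, V i) (y : Y) : ℝ :=
  ∑ x' ∈ univ.filter (fun x' => applyMask x' h = applyMask x h), p x' y * ζ x' h

/-- `p(y | x[s^in])`. -/
def condLabel (h : Mask d) (x : ∀ i, V i) (y : Y) : ℝ := pInY p h x y / pIn p h x

/-- `p(y | x[s^in], h[s^in]=1, h[s^ex]=0)`. -/
def condLabelSel (h : Mask d) (x : ∀ i, V i) (y : Y) : ℝ :=
  pInYSel p ζ h x y / pInSel p ζ h x

/-- `p(x[s^ex] | x[s^in])`. -/
def condFeat (h : Mask d) (x : ∀ i, V i) : ℝ := pX p x / pIn p h x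

/-- `p(x[s^ex] | x[s^in], h[s^in]=1, h[s^ex]=0)`. -/
def condFeatSel (h : Mask d) (x : ∀ i, V i) : ℝ :=
  (pX p x * ζ x h) / pInSel p ζ h x

/-- `p(h[s^in]=1, h[s^ex]=0 | x[s^in])`. -/
def condSel (h : Mask d) (x : ∀ i, V i) : ℝ := pInSel p ζ h x / pIn p h x

/-- `p(h[s^in]=1, h[s^ex]=0 | x[s^in], y)`. -/
def condSelY (h : Mask d) (x : ∀ i, V i) (y : Y) : ℝ :=
  pInYSel p ζ h x y / pInY p h x y

/-- `p(h[s^in]=1, h[s^ex]=0 | x[s^in], x[s^ex])`. -/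
def condSelX (h : Mask d) (x : ∀ i, V i) : ℝ := (pX p x * ζ x h) / pX p x

/-- `p(h[s^in]=1, h[s^ex]=0 | x[s^in], x[s^ex], y)`. -/
def condSelXY (h : Mask d) (x : ∀ i, V i) (y : Y) : ℝ := (p x y * ζ x h) / (p x y)

/-- `(x, y, s^in, s^ex) ∈ Ω`, where `s^in`/`s^ex` are the sets of features
selected/not selected by the mask `h`. -/
def InOmega (h : Mask d) (x : ∀ i, V i) (y : Y) : Prop :=
  0 < pX p x ∧ 0 < ζ x h ∧ 0 < pInY p h x y

/-- `ζ` has no label leakage: conditioning the label distribution on the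
selection of features by `ζ` does not change the label distribution. -/
def NoLabelLeakage : Prop :=
  ∀ (h : Mask d) (x : ∀ i, V i) (y : Y), InOmega p ζ h x y →
    condLabel p h x y = condLabelSel p ζ h x y

/-- `ζ` has no feature leakage: conditioning the feature distribution on the
selection of features by `ζ` does not change the feature distribution. -/
def NoFeatureLeakage : Prop :=
  ∀ (h : Mask d) (x : ∀ i, V i) (y : Y), InOmega p ζ h x y →
    condFeat p h x = condFeatSel p ζ h x

end Leakage

/-- The one-hot vector `e_i ∈ {0,1}³`. -/
def oneHot3 (i : Fin 3) : Fin 3 → Bool := fun j => decide (j = i)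

/-- The joint distribution: `x` uniform on `{e_1, e_2, e_3}` with labels
`y = 2, 1, 0` respectively. -/
def p13 (x : Fin 3 → Bool) (y : Fin 3) : ℝ :=
  if (x = oneHot3 0 ∧ y = 2) ∨ (x = oneHot3 1 ∧ y = 1) ∨ (x = oneHot3 2 ∧ y = 0)
  then 1 / 3 else 0

/-- The deterministic selector that, on input `e_i`, selects exactly the
feature `i` (whose value is 1); as boolean vectors the selected mask is `e_i`
itself. -/
def zeta13 (x : Fin 3 → Bool) (h : Mask 3) : ℝ := if h = x then 1 else 0

/-- The one-hot distribution vanishes off the one-hot vectors. -/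
theorem p13_eq_zero {x : Fin 3 → Bool} (hx : ∀ i, x ≠ oneHot3 i) (y : Fin 3) : p13 x y = 0 := by
  simp [p13, hx]

/-- A vector of positive probability is one-hot. -/
theorem exists_eq_oneHot3 {x : Fin 3 → Bool} (hx : 0 < pX p13 x) : ∃ i, x = oneHot3 i := by
  by_contra! h
  simp [pX, p13_eq_zero h] at hx

theorem eq_of_applyMask_oneHot3_eq {i j : Fin 3}
    (h : applyMask (oneHot3 j) (oneHot3 i) = applyMask (oneHot3 i) (oneHot3 i)) : j = i := by
  have := congrFun h i
  simp [applyMask, oneHot3] at this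
  exact this.symm

/-- Among the vectors that agree with a one-hot vector on its selected feature, only that
vector has positive probability. -/
theorem p13_eq_zero_of_applyMask_eq {i : Fin 3} {x : Fin 3 → Bool}
    (h : applyMask x (oneHot3 i) = applyMask (oneHot3 i) (oneHot3 i)) (hx : x ≠ oneHot3 i)
    (y : Fin 3) : p13 x y = 0 := by
  refine p13_eq_zero (fun j hj => hx ?_) y
  subst hj
  rw [eq_of_applyMask_oneHot3_eq h]

/-- A sum over the vectors that agree with a one-hot vector on its selected feature reduces to
one term. -/
theorem sum_applyMask_oneHot3 (i : Fin 3) (f : (Fin 3 → Bool) → ℝ)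
    (hf : ∀ x, (∀ y, p13 x y = 0) → f x = 0) :
    ∑ x ∈ univ.filter (fun x => applyMask x (oneHot3 i) = applyMask (oneHot3 i) (oneHot3 i)), f x =
      f (oneHot3 i) := by
  refine sum_eq_single_of_mem _ (by simp) fun x hx hne => hf x ?_
  exact p13_eq_zero_of_applyMask_eq (mem_filter.mp hx).2 hne

/-- A mask selected with positive probability is the input itself, which is one-hot. -/
theorem InOmega.exists_oneHot3 {h : Mask 3} {x : Fin 3 → Bool} {y : Fin 3}
    (hΩ : InOmega p13 zeta13 h x y) : ∃ i, x = oneHot3 i ∧ h = oneHot3 i := by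
  obtain ⟨i, hi⟩ := exists_eq_oneHot3 hΩ.1
  have hh : h = x := by
    by_contra hne
    simpa [zeta13, hne] using hΩ.2.1
  exact ⟨i, hi, hh.trans hi⟩

theorem pIn_oneHot3 (i : Fin 3) : pIn p13 (oneHot3 i) (oneHot3 i) = pX p13 (oneHot3 i) :=
  sum_applyMask_oneHot3 i _ fun x hx => by simp [pX, hx]

theorem pInY_oneHot3 (i y : Fin 3) : pInY p13 (oneHot3 i) (oneHot3 i) y = p13 (oneHot3 i) y :=
  sum_applyMask_oneHot3 i _ fun _ hx => hx y

theorem pInSel_oneHot3 (i : Fin 3) :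
    pInSel p13 zeta13 (oneHot3 i) (oneHot3 i) = pX p13 (oneHot3 i) :=
  (sum_applyMask_oneHot3 i _ fun x hx => by simp [pX, hx]).trans (by simp [zeta13])

theorem pInYSel_oneHot3 (i y : Fin 3) :
    pInYSel p13 zeta13 (oneHot3 i) (oneHot3 i) y = p13 (oneHot3 i) y :=
  (sum_applyMask_oneHot3 i _ fun x hx => by simp [hx]).trans (by simp [zeta13])

/-- a leakage-free deterministic selector under a non-product
feature distribution: this selector has no label leakage and no feature
leakage. -/
theorem oneHot_selector_no_leakage :
    NoLabelLeakage p13 zeta13 ∧ NoFeatureLeakage p13 zeta13 := by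
  constructor
  · intro h x y hΩ
    obtain ⟨i, rfl, rfl⟩ := hΩ.exists_oneHot3
    simp only [condLabel, condLabelSel, pIn_oneHot3, pInY_oneHot3, pInSel_oneHot3,
      pInYSel_oneHot3]
  · intro h x y hΩ
    obtain ⟨i, rfl, rfl⟩ := hΩ.exists_oneHot3
    simp [condFeat, condFeatSel, pIn_oneHot3, pInSel_oneHot3, zeta13]

end
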